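/- arXiv:1405.7022 — 2 statements merged into one kernel-verified Lean document; each statement's English description precedes it below -/
import Mathlib

section
/- For every ε > 0 there exists a constant C = C(ε) > 0 such that for all reals X ≥ 1 and N ≥ X^{1/2}, writing M = N^{2/3}, one has T(N,X) ≤ C · (X·M/N + N^{1/3+ε}). -/
/-- For `N, X > 0`, `T(N,X)` is the number of pairs `(m,n) ∈ ℤ × ℤ` with
`N ≤ n ≤ 2N` and `|n² − m³| ≤ X`. -/
noncomputable def T (N X : ℝ) : ℕ :=
  Set.ncard {p : ℤ × ℤ |
    N ≤ (p.2 : ℝ) ∧ (p.2 : ℝ) ≤ 2 * N ∧ |((p.2 : ℝ)) ^ 2 - ((p.1 : ℝ)) ^ 3| ≤ X}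

/-- The divisor bound. -/
theorem card_divisors_le_rpow {ε : ℝ} (hε : 0 < ε) :
    ∃ C : ℝ, 1 ≤ C ∧ ∀ n : ℕ, n ≠ 0 → (n.divisors.card : ℝ) ≤ C * (n : ℝ) ^ ε := by
  have hlog : 0 < Real.log 2 := Real.log_pos one_lt_two
  set K : ℝ := 1 + 1 / (ε * Real.log 2) with hK
  have hK1 : 1 ≤ K := by rw [hK]; have : 0 < 1 / (ε * Real.log 2) := by positivity
                         linarith
  set P : ℕ := ⌈(2 : ℝ) ^ (1 / ε)⌉₊ with hP
  refine ⟨K ^ P, one_le_pow₀ hK1, fun n hn => ?_⟩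
  have key : ∀ p ∈ n.primeFactors, ((n.factorization p + 1 : ℕ) : ℝ) ≤
      (if p < P then K else 1) * (((p ^ n.factorization p : ℕ) : ℝ) ^ ε) := by
    intro p hp
    have hp2 : 2 ≤ p := (Nat.prime_of_mem_primeFactors hp).two_le
    have hp2' : (2 : ℝ) ≤ p := by exact_mod_cast hp2
    set e := n.factorization p
    have hpow : (((p ^ e : ℕ) : ℝ) ^ ε) = ((p : ℝ) ^ ε) ^ e := by
      push_cast
      rw [← Real.rpow_natCast, ← Real.rpow_natCast, ← Real.rpow_mul (by positivity),
        ← Real.rpow_mul (by positivity), mul_comm]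
    rw [hpow]
    split_ifs with h
    · have h1 : ((2 : ℝ) ^ ε) ^ e ≤ ((p : ℝ) ^ ε) ^ e := by gcongr
      have h2 : (e : ℝ) * (ε * Real.log 2) + 1 ≤ ((2 : ℝ) ^ ε) ^ e := by
        rw [Real.rpow_def_of_pos two_pos, ← Real.exp_nat_mul]
        refine le_trans (le_of_eq ?_) (Real.add_one_le_exp _)
        ring
      refine le_trans ?_ (mul_le_mul_of_nonneg_left (h2.trans h1) (by linarith))
      rw [hK]; push_cast
      have h3 : (1 + 1 / (ε * Real.log 2)) * ((e : ℝ) * (ε * Real.log 2) + 1) =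
        e + 1 + (e * (ε * Real.log 2) + 1 / (ε * Real.log 2)) := by field_simp; ring
      rw [h3]
      have : 0 ≤ (e * (ε * Real.log 2) + 1 / (ε * Real.log 2)) := by positivity
      linarith
    · have h1 : (2 : ℝ) ≤ (p : ℝ) ^ ε := by
        have h2 : (2 : ℝ) ^ (1 / ε) ≤ p := (Nat.le_ceil _).trans (by exact_mod_cast not_lt.1 h)
        calc (2 : ℝ) = ((2 : ℝ) ^ (1 / ε)) ^ ε := by
              rw [← Real.rpow_mul two_pos.le]; field_simp; simp
          _ ≤ _ := by gcongr
      rw [one_mul]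
      calc ((e + 1 : ℕ) : ℝ) ≤ (2 : ℝ) ^ e := by exact_mod_cast Nat.lt_two_pow_self
        _ ≤ _ := by gcongr
  have hprod : (∏ p ∈ n.primeFactors, (((p ^ n.factorization p : ℕ) : ℝ) ^ ε)) = (n : ℝ) ^ ε := by
    rw [Real.finsetProd_rpow _ _ (fun _ _ => by positivity)]
    congr 1
    rw [← Nat.cast_prod]
    congr 1
    exact Nat.prod_factorization_pow_eq_self hn
  rw [Nat.card_divisors hn, Nat.cast_prod]
  refine (Finset.prod_le_prod (fun _ _ => by positivity) key).trans ?_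
  rw [Finset.prod_mul_distrib, hprod]
  gcongr
  rw [Finset.prod_ite, Finset.prod_const, Finset.prod_const_one, mul_one]
  refine pow_le_pow_right₀ hK1 ?_
  calc _ ≤ (Finset.range P).card := Finset.card_le_card (by
        intro p; simp only [Finset.mem_filter, Finset.mem_range]; exact fun h => h.2)
    _ = P := Finset.card_range P

/-- A `d`-separated set of integers in an interval of length `2 * W` has at most
`2 * W / d + 1` elements. -/
theorem card_le_of_separated (s : Finset ℤ) {d c W : ℝ} (hd : 0 < d) (hW : 0 ≤ W)
    (hs : ∀ x ∈ s, |(x : ℝ) - c| ≤ W)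
    (sep : ∀ x ∈ s, ∀ y ∈ s, x < y → d ≤ (y : ℝ) - x) :
    (s.card : ℝ) ≤ 2 * W / d + 1 := by
  set f : ℤ → ℕ := fun x => ⌊((x : ℝ) - (c - W)) / d⌋₊
  have hnn : ∀ x ∈ s, 0 ≤ ((x : ℝ) - (c - W)) / d := fun x hx => by
    have := (abs_le.1 (hs x hx)).1
    apply div_nonneg _ hd.le; linarith
  have hlt : ∀ x ∈ s, ∀ y ∈ s, x < y → f x < f y := by
    intro x hx y hy hxy
    have h1 : ((x : ℝ) - (c - W)) / d + 1 ≤ ((y : ℝ) - (c - W)) / d := by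
      rw [div_add_one hd.ne']
      gcongr
      linarith [sep x hx y hy hxy]
    have := Nat.floor_le_floor h1
    rw [Nat.floor_add_one (hnn x hx)] at this
    exact this
  have hinj : Set.InjOn f s := by
    intro x hx y hy hxy
    rcases lt_trichotomy x y with h | h | h
    · exact absurd hxy (hlt x hx y hy h).ne
    · exact h
    · exact absurd hxy (hlt y hy x hx h).ne'
  have hcard : s.card ≤ (Finset.range (⌊2 * W / d⌋₊ + 1)).card := by
    refine Finset.card_le_card_of_injOn f (fun x hx => ?_) hinj
    rw [Finset.mem_coe, Finset.mem_range, Nat.lt_succ_iff]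
    apply Nat.floor_le_floor
    have := (abs_le.1 (hs x hx)).2
    gcongr; linarith
  rw [Finset.card_range] at hcard
  calc (s.card : ℝ) ≤ (⌊2 * W / d⌋₊ : ℝ) + 1 := by exact_mod_cast hcard
    _ ≤ _ := by gcongr; exact Nat.floor_le (by positivity)

/-- If `a ≡ a' (mod q)` give the same value of `a ^ 3 - 3 a q² m + 2 q³ n`, then the
corresponding `q² m - a²` agree modulo `q² / gcd (3, q²)`. -/
theorem sq_dvd_three_mul_sub {q a a' m m' n n' : ℤ} (hq : q ≠ 0) (hc : IsCoprime a q)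
    (hd : q ∣ a' - a)
    (hl : a ^ 3 - 3 * a * q ^ 2 * m + 2 * q ^ 3 * n =
      a' ^ 3 - 3 * a' * q ^ 2 * m' + 2 * q ^ 3 * n') :
    q ^ 2 ∣ 3 * ((q ^ 2 * m' - a' ^ 2) - (q ^ 2 * m - a ^ 2)) := by
  obtain ⟨t, ht⟩ := hd
  obtain rfl : a' = a + q * t := by linarith
  have h1 : q ∣ 3 * t := by
    have h2 : q * q ∣ q * (a ^ 2 * (3 * t)) := by
      refine ⟨-(3 * a * t ^ 2 + q * t ^ 3) - 3 * a * m + 2 * q * n + 3 * (a + q * t) * m'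
        - 2 * q * n', ?_⟩
      linear_combination -hl
    exact (IsCoprime.pow_right hc.symm).dvd_of_dvd_mul_left ((mul_dvd_mul_iff_left hq).1 h2)
  obtain ⟨u, hu⟩ := h1
  refine ⟨3 * m' - 3 * m - u * (2 * a + q * t), ?_⟩
  linear_combination (-q * (2 * a + q * t)) * hu

theorem cube_dvd_mul_sub {q a a' m m' n n' : ℤ} (hc : IsCoprime a q) (hd : q ∣ a' - a)
    (hl : a ^ 3 - 3 * a * q ^ 2 * m + 2 * q ^ 3 * n =
      a' ^ 3 - 3 * a' * q ^ 2 * m' + 2 * q ^ 3 * n')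
    (hr : q ^ 2 * m - a ^ 2 = q ^ 2 * m' - a' ^ 2) :
    q ^ 3 ∣ 27 * (a' - a) := by
  set F := 2 * (a' ^ 2 + a * a' + a ^ 2) + 3 * (q ^ 2 * m - a ^ 2) with hF
  have h1 : q ^ 3 ∣ F * (a' - a) := by
    refine ⟨2 * (n' - n), ?_⟩
    rw [hF]
    linear_combination hl + 3 * a' * hr
  have h2 : gcd F q ∣ 3 := by
    have h3 : gcd F q ∣ a ^ 2 * 3 := by
      have h4 : gcd F q ∣ q := gcd_dvd_right _ _
      have h5 : gcd F q ∣ F := gcd_dvd_left _ _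
      obtain ⟨t, ht⟩ := hd
      have h6 : a ^ 2 * 3 = F - q * (2 * (2 * a * t + q * t ^ 2 + a * t) + 3 * q * m) := by
        obtain rfl : a' = a + q * t := by linarith
        rw [hF]; ring
      rw [h6]
      exact dvd_sub h5 (h4.mul_right _)
    have h7 : IsCoprime (gcd F q) (a ^ 2) :=
      IsCoprime.of_isCoprime_of_dvd_left (IsCoprime.pow_right hc.symm) (gcd_dvd_right _ _)
    exact h7.dvd_of_dvd_mul_left h3
  have h8 : gcd F (q ^ 3) ∣ 27 :=
    (gcd_pow_right_dvd_pow_gcd).trans ((pow_dvd_pow_of_dvd h2 3).trans (by norm_num))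
  have h9 : q ^ 3 ∣ gcd F (q ^ 3) * (a' - a) := by
    have := dvd_gcd h1 (dvd_mul_right (q ^ 3) (a' - a))
    exact this.trans (gcd_mul_right' _ _ _).dvd
  exact h9.trans (mul_dvd_mul_right h8 _)

/-- For `p = (a, m, n)`, the integer `q² m - a²`. -/
def sqResidue (q : ℤ) (p : ℤ × ℤ × ℤ) : ℤ := q ^ 2 * p.2.1 - p.1 ^ 2

/-- For `p = (a, m, n)`, the integer `a³ - 3 a q² m + 2 q³ n`. -/
def cubeResidue (q : ℤ) (p : ℤ × ℤ × ℤ) : ℤ :=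
  p.1 ^ 3 - 3 * p.1 * q ^ 2 * p.2.1 + 2 * q ^ 3 * p.2.2

/-- `p = (a, m, n)` where `n` is within `η²` of `m ^ (3/2)` and `a / q` is a reduced fraction
within `η / q` of `√m`. -/
structure IsApprox (Y η : ℝ) (q : ℤ) (p : ℤ × ℤ × ℤ) : Prop where
  one_le_num : 1 ≤ p.1
  one_le : 1 ≤ p.2.1
  coprime : IsCoprime p.1 q
  sqrt_le : √(p.2.1 : ℝ) ≤ 2 * Y
  abs_sub_num_le : |q * √(p.2.1 : ℝ) - p.1| ≤ η
  abs_sub_cube_le : |(p.2.2 : ℝ) - √(p.2.1 : ℝ) ^ 3| ≤ η ^ 2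

/-- The admissible ranges of the parameters in `IsApprox`. -/
structure Admissible (Y η : ℝ) (q : ℤ) : Prop where
  one_le : 1 ≤ q
  pos : 0 < η
  mul_le_one : q * η ≤ 1
  one_le_mul : 1 ≤ Y * η ^ 2

namespace Admissible

variable {Y η : ℝ} {q : ℤ}

theorem one_le_cast (h : Admissible Y η q) : (1 : ℝ) ≤ q := by exact_mod_cast h.one_le

theorem le_one (h : Admissible Y η q) : η ≤ 1 := by
  nlinarith [h.one_le_cast, h.pos, h.mul_le_one]

theorem Y_pos (h : Admissible Y η q) : 0 < Y :=
  pos_of_mul_pos_left (lt_of_lt_of_le one_pos h.one_le_mul) (sq_nonneg η)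

theorem one_le_Y (h : Admissible Y η q) : 1 ≤ Y :=
  h.one_le_mul.trans (mul_le_of_le_one_right h.Y_pos.le (pow_le_one₀ h.pos.le h.le_one))

theorem sq_mul_sq_le (h : Admissible Y η q) : (q : ℝ) ^ 2 * η ^ 2 ≤ 1 := by
  rw [← mul_pow]
  exact pow_le_one₀ (mul_nonneg (by linarith [h.one_le_cast]) h.pos.le) h.mul_le_one

theorem sq_le (h : Admissible Y η q) : (q : ℝ) ^ 2 ≤ Y := by
  have h1 : 0 < η ^ 2 := pow_pos h.pos 2
  have h2 := h.sq_mul_sq_le.trans h.one_le_mul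
  exact le_of_mul_le_mul_right h2 h1

theorem one_le_sqrt_mul (h : Admissible Y η q) : 1 ≤ √Y * η := by
  rw [← Real.sqrt_sq h.pos.le, ← Real.sqrt_mul h.Y_pos.le]
  exact Real.one_le_sqrt.2 h.one_le_mul

end Admissible

namespace IsApprox

variable {Y η : ℝ} {q : ℤ} {p p' : ℤ × ℤ × ℤ}

theorem one_le_num_cast (hp : IsApprox Y η q p) : (1 : ℝ) ≤ p.1 := by
  exact_mod_cast hp.one_le_num

theorem sq_sqrt_cast (hp : IsApprox Y η q p) : √(p.2.1 : ℝ) ^ 2 = p.2.1 := by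
  refine Real.sq_sqrt ?_
  have : (1 : ℝ) ≤ p.2.1 := by exact_mod_cast hp.one_le
  linarith

theorem num_le (hp : IsApprox Y η q p) (h : Admissible Y η q) : (p.1 : ℝ) ≤ 3 * (q * Y) := by
  have h1 := (abs_le.1 hp.abs_sub_num_le).1
  have h2 := h.one_le_cast
  have h3 := h.one_le_Y
  have h4 := h.le_one
  have h5 : q * √(p.2.1 : ℝ) ≤ q * (2 * Y) := by gcongr; exact hp.sqrt_le
  nlinarith

/-- The residues in terms of `θ = q √m - a` and `ν = n - m ^ (3/2)`. -/
theorem exists_residues_eq (hp : IsApprox Y η q p) :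
    ∃ θ ν : ℝ, |θ| ≤ η ∧ |ν| ≤ η ^ 2 ∧
      (cubeResidue q p : ℝ) = θ ^ 2 * (3 * p.1 + 2 * θ) + 2 * q ^ 3 * ν ∧
      (sqResidue q p : ℝ) = θ * (2 * p.1 + θ) := by
  refine ⟨_, _, hp.abs_sub_num_le, hp.abs_sub_cube_le, ?_, ?_⟩
  · simp only [cubeResidue]; push_cast
    rw [← hp.sq_sqrt_cast, Real.sqrt_sq (Real.sqrt_nonneg _)]
    ring
  · simp only [sqResidue]; push_cast
    rw [← hp.sq_sqrt_cast, Real.sqrt_sq (Real.sqrt_nonneg _)]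
    ring

theorem abs_cubeResidue_le (hp : IsApprox Y η q p) (h : Admissible Y η q) :
    |(cubeResidue q p : ℝ)| ≤ 13 * (q * Y * η ^ 2) := by
  obtain ⟨θ, ν, hθ, hν, hl, -⟩ := hp.exists_residues_eq
  have hq := h.one_le_cast
  have ha := hp.one_le_num_cast
  have hY := h.one_le_Y
  have hθ2 : θ ^ 2 ≤ η ^ 2 := sq_le_sq' (abs_le.1 hθ).1 (abs_le.1 hθ).2
  have h1 : |θ ^ 2 * (3 * p.1 + 2 * θ)| ≤ η ^ 2 * (11 * (q * Y)) := by
    rw [abs_mul, abs_of_nonneg (sq_nonneg θ)]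
    have h2 : |3 * (p.1 : ℝ) + 2 * θ| ≤ 11 * (q * Y) := by
      have h3 := hp.num_le h
      have h4 := abs_le.1 (hθ.trans h.le_one)
      have h5 : 1 ≤ q * Y := one_le_mul_of_one_le_of_one_le hq hY
      rw [abs_le]; constructor <;> linarith [h4.1, h4.2]
    gcongr
  have h2 : |2 * (q : ℝ) ^ 3 * ν| ≤ 2 * (q * Y) * η ^ 2 := by
    rw [abs_mul, abs_of_nonneg (by positivity)]
    have h3 : (q : ℝ) ^ 3 ≤ q * Y := by
      nlinarith [h.sq_le]
    gcongr
  rw [hl]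
  calc _ ≤ _ := abs_add_le _ _
    _ ≤ _ := add_le_add h1 h2
    _ = _ := by ring

theorem abs_three_mul_sq_sub_le (hp : IsApprox Y η q p) (h : Admissible Y η q) :
    |3 * (sqResidue q p : ℝ) ^ 2 - 4 * p.1 * cubeResidue q p| ≤ 45 * (q ^ 4 * Y * η ^ 2) := by
  obtain ⟨θ, ν, hθ, hν, hl, hr⟩ := hp.exists_residues_eq
  have hq := h.one_le_cast
  have ha := hp.one_le_num_cast
  have hη := h.pos
  have hη1 := h.le_one
  have key : 3 * (sqResidue q p : ℝ) ^ 2 - 4 * p.1 * cubeResidue q p =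
      4 * p.1 * θ ^ 3 + 3 * θ ^ 4 - 8 * p.1 * q ^ 3 * ν := by
    rw [hl, hr]; ring
  have hq3 : (1 : ℝ) ≤ q ^ 3 := one_le_pow₀ hq
  have haq : 1 ≤ p.1 * (q : ℝ) ^ 3 := one_le_mul_of_one_le_of_one_le ha hq3
  have h1 : |4 * p.1 * θ ^ 3| ≤ 4 * (p.1 * q ^ 3) * η ^ 2 := by
    rw [abs_mul, abs_of_nonneg (by positivity), abs_pow]
    have : |θ| ^ 3 ≤ η ^ 2 := (pow_le_pow_left₀ (abs_nonneg _) hθ 3).trans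
      (pow_le_pow_of_le_one hη.le hη1 (by norm_num))
    gcongr
    nlinarith
  have h2 : |3 * θ ^ 4| ≤ 3 * (p.1 * q ^ 3) * η ^ 2 := by
    rw [abs_mul, abs_of_nonneg (by positivity), abs_pow]
    have : |θ| ^ 4 ≤ η ^ 2 := (pow_le_pow_left₀ (abs_nonneg _) hθ 4).trans
      (pow_le_pow_of_le_one hη.le hη1 (by norm_num))
    gcongr
    nlinarith
  have h3 : |8 * p.1 * (q : ℝ) ^ 3 * ν| ≤ 8 * (p.1 * q ^ 3) * η ^ 2 := by
    rw [abs_mul, abs_of_nonneg (by positivity), ← mul_assoc 8]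
    gcongr
  have h4 : |4 * p.1 * θ ^ 3 + 3 * θ ^ 4 - 8 * p.1 * (q : ℝ) ^ 3 * ν| ≤
      15 * (p.1 * q ^ 3) * η ^ 2 := by
    refine (abs_sub _ _).trans ((add_le_add_left (abs_add_le _ _) _).trans ?_)
    linarith
  rw [key]
  refine h4.trans ?_
  calc 15 * (p.1 * (q : ℝ) ^ 3) * η ^ 2 ≤ 15 * (3 * (q * Y) * (q : ℝ) ^ 3) * η ^ 2 := by
        gcongr; exact hp.num_le h
    _ = _ := by ring

theorem sqResidue_sq_le (hp : IsApprox Y η q p) (h : Admissible Y η q) :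
    (sqResidue q p : ℝ) ^ 2 ≤
      4 * (q * Y) * |(cubeResidue q p : ℝ)| + 15 * (q ^ 4 * Y * η ^ 2) := by
  have h1 := (abs_le.1 (hp.abs_three_mul_sq_sub_le h)).2
  have h2 : 4 * p.1 * (cubeResidue q p : ℝ) ≤ 4 * (3 * (q * Y)) * |(cubeResidue q p : ℝ)| := by
    have ha := hp.one_le_num_cast
    calc 4 * p.1 * (cubeResidue q p : ℝ) ≤ 4 * p.1 * |(cubeResidue q p : ℝ)| := by
          gcongr; exact le_abs_self _
      _ ≤ _ := by gcongr; exact hp.num_le h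
  linarith

theorem eq_of_residues_eq (hq : q ≠ 0) (h1 : p.1 = p'.1) (hr : sqResidue q p = sqResidue q p')
    (hl : cubeResidue q p = cubeResidue q p') : p = p' := by
  obtain ⟨a, m, n⟩ := p
  obtain ⟨a', m', n'⟩ := p'
  simp only [sqResidue, cubeResidue] at *
  subst h1
  have hm : m = m' := mul_left_cancel₀ (pow_ne_zero 2 hq) (by linarith)
  subst hm
  have hn : n = n' := mul_left_cancel₀ (mul_ne_zero two_ne_zero (pow_ne_zero 3 hq)) (by linarith)
  rw [hn]

end IsApprox

section Fibers

variable {Y η : ℝ} {q l : ℤ} {P : Finset (ℤ × ℤ × ℤ)}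

/-- Points with equal residues and `a` in a fixed class modulo `q`. -/
theorem card_le_of_residues_eq (h : Admissible Y η q) (hP : ∀ p ∈ P, IsApprox Y η q p)
    (hl0 : l ≠ 0) (hl : ∀ p ∈ P, cubeResidue q p = l) {r : ℤ}
    (hr : ∀ p ∈ P, sqResidue q p = r) (ha : ∀ p ∈ P, ∀ p' ∈ P, q ∣ p'.1 - p.1) :
    (P.card : ℝ) ≤ 661 * (q * Y * η ^ 2) / |(l : ℝ)| := by
  have hq := h.one_le_cast
  have hq0 : q ≠ 0 := by have := h.one_le; omega
  have hY := h.Y_pos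
  have hlpos : 0 < |(l : ℝ)| := abs_pos.2 (by exact_mod_cast hl0)
  rcases P.eq_empty_or_nonempty with rfl | ⟨p0, hp0⟩
  · simp only [Finset.card_empty, Nat.cast_zero]; positivity
  have hinj : Set.InjOn (fun p : ℤ × ℤ × ℤ => p.1) P := fun p hp p' hp' hpp =>
    IsApprox.eq_of_residues_eq hq0 hpp ((hr p hp).trans (hr p' hp').symm)
      ((hl p hp).trans (hl p' hp').symm)
  rw [← Finset.card_image_of_injOn hinj]
  have hb := card_le_of_separated (P.image fun p : ℤ × ℤ × ℤ => p.1)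
    (d := (q : ℝ) ^ 3 / 27) (c := 3 * (r : ℝ) ^ 2 / (4 * l))
    (W := 12 * (q ^ 4 * Y * η ^ 2) / |(l : ℝ)|) (by positivity) (by positivity) ?_ ?_
  · refine hb.trans ?_
    have h1 : 1 ≤ 13 * (q * Y * η ^ 2) / |(l : ℝ)| := by
      rw [one_le_div hlpos, ← hl p0 hp0]
      exact (hP p0 hp0).abs_cubeResidue_le h
    have h2 : 2 * (12 * (q ^ 4 * Y * η ^ 2) / |(l : ℝ)|) / ((q : ℝ) ^ 3 / 27) =
      648 * (q * Y * η ^ 2) / |(l : ℝ)| := by field_simp; ring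
    rw [h2]
    refine (add_le_add_right h1 _).trans (le_of_eq ?_)
    ring
  · intro x hx
    obtain ⟨p, hp, rfl⟩ := Finset.mem_image.1 hx
    have h1 := (hP p hp).abs_three_mul_sq_sub_le h
    rw [hl p hp, hr p hp] at h1
    have hl' : (l : ℝ) ≠ 0 := by exact_mod_cast hl0
    have h2 : (p.1 : ℝ) - 3 * (r : ℝ) ^ 2 / (4 * l) =
        -(3 * (r : ℝ) ^ 2 - 4 * p.1 * l) / (4 * l) := by field_simp; ring
    rw [h2, abs_div, abs_neg, abs_mul, abs_of_pos (by norm_num : (0 : ℝ) < 4),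
      div_le_div_iff₀ (by positivity) hlpos]
    have : 0 ≤ q ^ 4 * Y * η ^ 2 := by positivity
    nlinarith
  · intro x hx y hy hxy
    obtain ⟨p, hp, rfl⟩ := Finset.mem_image.1 hx
    obtain ⟨p', hp', rfl⟩ := Finset.mem_image.1 hy
    have h1 := cube_dvd_mul_sub (hP p hp).coprime (ha p hp p' hp')
      ((hl p hp).trans (hl p' hp').symm) ((hr p hp).trans (hr p' hp').symm)
    have h2 := Int.le_of_dvd (by omega) h1
    have h3 : (q : ℝ) ^ 3 ≤ 27 * (p'.1 - p.1) := by exact_mod_cast h2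
    linarith

/-- The number of values of `q² m - a²` when `a³ - 3 a q² m + 2 q³ n` and `a` modulo `q`
are fixed. -/
theorem card_image_sqResidue_le (h : Admissible Y η q) (hP : ∀ p ∈ P, IsApprox Y η q p)
    (hl : ∀ p ∈ P, cubeResidue q p = l) (ha : ∀ p ∈ P, ∀ p' ∈ P, q ∣ p'.1 - p.1) {W : ℝ}
    (hW : 0 ≤ W) (hWP : ∀ p ∈ P, (sqResidue q p : ℝ) ^ 2 ≤ W ^ 2) :
    ((P.image (sqResidue q)).card : ℝ) ≤ 6 * W / q ^ 2 + 1 := by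
  have hq := h.one_le_cast
  have hq0 : q ≠ 0 := by have := h.one_le; omega
  have hb := card_le_of_separated (P.image (sqResidue q)) (d := (q : ℝ) ^ 2 / 3) (c := 0)
    (W := W) (by positivity) hW ?_ ?_
  · refine hb.trans (le_of_eq ?_)
    field_simp; ring
  · intro x hx
    obtain ⟨p, hp, rfl⟩ := Finset.mem_image.1 hx
    rw [sub_zero]
    exact abs_le_of_sq_le_sq (hWP p hp) hW
  · intro x hx y hy hxy
    obtain ⟨p, hp, rfl⟩ := Finset.mem_image.1 hx
    obtain ⟨p', hp', rfl⟩ := Finset.mem_image.1 hy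
    have h1 : q ^ 2 ∣ 3 * (sqResidue q p' - sqResidue q p) :=
      sq_dvd_three_mul_sub hq0 (hP p hp).coprime (ha p hp p' hp')
        ((hl p hp).trans (hl p' hp').symm)
    have h2 := Int.le_of_dvd (by omega) h1
    have h3 : (q : ℝ) ^ 2 ≤ 3 * (sqResidue q p' - sqResidue q p) := by exact_mod_cast h2
    linarith

theorem card_le_mul_card_image_of_le {α β : Type*} [DecidableEq β] (s : Finset α) (f : α → β)
    {B : ℝ} (hB : ∀ b ∈ s.image f, ((s.filter fun x => f x = b).card : ℝ) ≤ B) :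
    (s.card : ℝ) ≤ B * (s.image f).card := by
  rw [Finset.card_eq_sum_card_image f s, Nat.cast_sum]
  refine (Finset.sum_le_card_nsmul _ _ B hB).trans (le_of_eq ?_)
  rw [nsmul_eq_mul, mul_comm]

theorem card_le_of_cubeResidue_eq (h : Admissible Y η q) (hP : ∀ p ∈ P, IsApprox Y η q p)
    (hl0 : l ≠ 0) (hl : ∀ p ∈ P, cubeResidue q p = l)
    (ha : ∀ p ∈ P, ∀ p' ∈ P, q ∣ p'.1 - p.1) :
    (P.card : ℝ) ≤ 20491 * (Y * η ^ 2) * √(q * Y * max |(l : ℝ)| q) / (q * |(l : ℝ)|) := by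
  have hq := h.one_le_cast
  have hY := h.Y_pos
  have hlpos : 0 < |(l : ℝ)| := abs_pos.2 (by exact_mod_cast hl0)
  set Λ := max |(l : ℝ)| q with hΛ
  have hΛl : |(l : ℝ)| ≤ Λ := le_max_left _ _
  have hΛq : (q : ℝ) ≤ Λ := le_max_right _ _
  have hΛ0 : 0 < Λ := by linarith
  have hr := card_image_sqResidue_le h hP hl ha (W := 5 * √(q * Y * Λ)) (by positivity) (by
    intro p hp
    have h1 := (hP p hp).sqResidue_sq_le h
    rw [hl p hp] at h1
    rw [mul_pow, Real.sq_sqrt (by positivity)]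
    have h2 : 4 * (q * Y) * |(l : ℝ)| ≤ 4 * (q * Y) * Λ := by gcongr
    have h3 : q ^ 4 * Y * η ^ 2 ≤ q * Y * Λ := by
      calc q ^ 4 * Y * η ^ 2 = q * Y * (q * (q ^ 2 * η ^ 2)) := by ring
        _ ≤ q * Y * (Λ * 1) := by
          gcongr
          exact h.sq_mul_sq_le
        _ = _ := by ring
    have h4 : 0 < q * Y * Λ := by positivity
    linarith)
  have hone : 1 ≤ √(q * Y * Λ) / q ^ 2 := by
    rw [one_le_div (by positivity)]
    apply Real.le_sqrt_of_sq_le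
    calc ((q : ℝ) ^ 2) ^ 2 = q * q ^ 2 * q := by ring
      _ ≤ q * Y * Λ := by gcongr; exact h.sq_le
  have hr' : ((P.image (sqResidue q)).card : ℝ) ≤ 31 * √(q * Y * Λ) / q ^ 2 := by
    refine (hr.trans (add_le_add_right hone _)).trans (le_of_eq ?_)
    ring
  refine (card_le_mul_card_image_of_le P (sqResidue q)
    (B := 661 * (q * Y * η ^ 2) / |(l : ℝ)|) ?_).trans ?_
  · intro r _
    refine card_le_of_residues_eq h (fun p hp => hP p (Finset.mem_filter.1 hp).1) hl0
      (fun p hp => hl p (Finset.mem_filter.1 hp).1) (r := r)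
      (fun p hp => (Finset.mem_filter.1 hp).2)
      (fun p hp p' hp' => ha p (Finset.mem_filter.1 hp).1 p' (Finset.mem_filter.1 hp').1)
  · refine (mul_le_mul_of_nonneg_left hr' (by positivity)).trans (le_of_eq ?_)
    field_simp; ring

theorem card_le_of_cubeResidue_eq_zero (h : Admissible Y η 1)
    (hP : ∀ p ∈ P, IsApprox Y η 1 p) (hl : ∀ p ∈ P, cubeResidue 1 p = 0) :
    (P.card : ℝ) ≤ 175 * (Y * √Y * η) := by
  have hY := h.Y_pos
  have hη := h.pos
  have hr := card_image_sqResidue_le h hP hl (fun _ _ _ _ => one_dvd _) (W := 4 * √Y * η)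
    (by positivity) (by
    intro p hp
    have h1 := (hP p hp).sqResidue_sq_le h
    rw [hl p hp] at h1
    rw [mul_pow, mul_pow, Real.sq_sqrt (by positivity)]
    simp only [Int.cast_zero, abs_zero, Int.cast_one] at h1
    have : 0 < Y * η ^ 2 := by positivity
    linarith)
  have hr' : ((P.image (sqResidue 1)).card : ℝ) ≤ 25 * (√Y * η) := by
    refine (hr.trans (add_le_add_right h.one_le_sqrt_mul _)).trans (le_of_eq ?_)
    push_cast; ring
  refine (card_le_mul_card_image_of_le P (sqResidue 1) (B := 7 * Y) ?_).trans ?_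
  · intro r _
    have hinj : Set.InjOn (fun p : ℤ × ℤ × ℤ => p.1)
        (P.filter fun p => sqResidue 1 p = r : Finset (ℤ × ℤ × ℤ)) := by
      intro p hp p' hp' hpp
      simp only [Finset.coe_filter, Set.mem_ofPred_eq] at hp hp'
      exact IsApprox.eq_of_residues_eq one_ne_zero hpp (hp.2.trans hp'.2.symm)
        ((hl p hp.1).trans (hl p' hp'.1).symm)
    rw [← Finset.card_image_of_injOn hinj]
    refine (card_le_of_separated _ (d := 1) (c := 0) (W := 3 * Y) one_pos (by positivity)
      ?_ ?_).trans ?_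
    · intro x hx
      obtain ⟨p, hp, rfl⟩ := Finset.mem_image.1 hx
      have hp' := hP p (Finset.mem_filter.1 hp).1
      have h1 := hp'.num_le h
      have h2 := hp'.one_le_num_cast
      rw [sub_zero, abs_of_nonneg (by linarith)]
      simpa using h1
    · intro x _ y _ hxy
      have : (x : ℝ) + 1 ≤ y := by exact_mod_cast hxy
      linarith
    · have := h.one_le_Y
      rw [div_one]; linarith
  · refine (mul_le_mul_of_nonneg_left hr' (by positivity)).trans (le_of_eq ?_)
    ring

end Fibers

theorem sum_Icc_inv_sqrt_le (K : ℕ) : ∑ k ∈ Finset.Icc 1 K, 1 / √(k : ℝ) ≤ 2 * √(K : ℝ) := by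
  induction K with
  | zero => simp
  | succ K ih =>
    rw [Finset.sum_Icc_succ_top (by omega)]
    refine (add_le_add_left ih _).trans ?_
    have h1 : 0 < √((K + 1 : ℕ) : ℝ) := Real.sqrt_pos.2 (by positivity)
    have h2 : √((K + 1 : ℕ) : ℝ) ^ 2 = K + 1 := by
      rw [Real.sq_sqrt (by positivity)]; push_cast; ring
    have h3 : √(K : ℝ) ^ 2 = K := Real.sq_sqrt (by positivity)
    rw [← le_sub_iff_add_le', div_le_iff₀ h1]
    nlinarith [sq_nonneg (√((K + 1 : ℕ) : ℝ) - √(K : ℝ))]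

theorem dvd_num_pow_sub_cubeResidue (q : ℤ) (p : ℤ × ℤ × ℤ) : q ∣ p.1 ^ 3 - cubeResidue q p :=
  ⟨3 * p.1 * q * p.2.1 - 2 * q ^ 2 * p.2.2, by rw [cubeResidue]; ring⟩

theorem dvd_cubeResidue_sub {q : ℤ} {p p' : ℤ × ℤ × ℤ} (h : q ∣ p'.1 - p.1) :
    q ∣ cubeResidue q p' - cubeResidue q p := by
  have h1 : q ∣ p'.1 ^ 3 - p.1 ^ 3 := h.trans (sub_dvd_pow_sub_pow _ _ 3)
  have h2 := (h1.sub (dvd_num_pow_sub_cubeResidue q p')).add (dvd_num_pow_sub_cubeResidue q p)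
  rwa [show p'.1 ^ 3 - p.1 ^ 3 - (p'.1 ^ 3 - cubeResidue q p') + (p.1 ^ 3 - cubeResidue q p) =
    cubeResidue q p' - cubeResidue q p by ring] at h2

theorem eq_of_dvd_sub_of_ediv_eq {q l l' : ℤ} (h : q ∣ l' - l)
    (hs : l < 0 ↔ l' < 0) (hd : |l| / q = |l'| / q) : l = l' := by
  have h1 : q ∣ |l'| - |l| := by
    rcases lt_or_ge l 0 with h0 | h0
    · rw [abs_of_neg h0, abs_of_neg (hs.1 h0)]
      rw [← dvd_neg, show -(-l' - -l) = l' - l by ring]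
      exact h
    · rw [abs_of_nonneg h0, abs_of_nonneg (not_lt.1 fun h' => h0.not_gt (hs.2 h'))]
      exact h
  have h2 : |l| % q = |l'| % q := Int.modEq_iff_dvd.2 h1
  have h3 : |l| = |l'| := by
    rw [← Int.emod_add_mul_ediv |l| q, ← Int.emod_add_mul_ediv |l'| q, h2, hd]
  rcases lt_or_ge l 0 with h0 | h0
  · rw [abs_of_neg h0, abs_of_neg (hs.1 h0)] at h3; omega
  · rwa [abs_of_nonneg h0, abs_of_nonneg (not_lt.1 fun h' => h0.not_gt (hs.2 h'))] at h3

section Moduli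

variable {Y η : ℝ} {q : ℤ} {P : Finset (ℤ × ℤ × ℤ)}

theorem card_le_of_le_abs_cubeResidue (h : Admissible Y η q) (hP : ∀ p ∈ P, IsApprox Y η q p)
    (hl : ∀ p ∈ P, q ≤ |cubeResidue q p|) : (P.card : ℝ) ≤ 327856 * (Y ^ 2 * η ^ 3) := by
  have hq := h.one_le_cast
  have hq0 : 0 < q := by have := h.one_le; omega
  have hY := h.Y_pos
  have hη := h.pos
  set K : ℕ := ⌊13 * (Y * η ^ 2)⌋₊ with hK
  set key : ℤ × ℤ × ℤ → ℤ × Bool × ℕ := fun p =>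
    (p.1 % q, decide (cubeResidue q p < 0), (|cubeResidue q p| / q).toNat) with hkey
  have hdivnn : ∀ p, 0 ≤ |cubeResidue q p| / q := fun p =>
    Int.ediv_nonneg (abs_nonneg _) hq0.le
  have hdivle : ∀ p, (((|cubeResidue q p| / q).toNat : ℕ) : ℝ) * q ≤ |(cubeResidue q p : ℝ)| := by
    intro p
    have h1 : (((|cubeResidue q p| / q).toNat : ℕ) : ℤ) * q ≤ |cubeResidue q p| := by
      rw [Int.toNat_of_nonneg (hdivnn p)]
      exact Int.ediv_mul_le _ hq0.ne'
    exact_mod_cast h1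
  have hmaps : ∀ p ∈ P, key p ∈
      Finset.Ico 0 q ×ˢ ((Finset.univ : Finset Bool) ×ˢ Finset.Icc 1 K) := by
    intro p hp
    simp only [hkey, Finset.mem_product, Finset.mem_Ico, Finset.mem_univ, true_and,
      Finset.mem_Icc]
    refine ⟨⟨Int.emod_nonneg _ hq0.ne', Int.emod_lt_of_pos _ hq0⟩, ?_, ?_⟩
    · have : 1 ≤ |cubeResidue q p| / q := by
        rw [Int.le_ediv_iff_mul_le hq0, one_mul]; exact hl p hp
      omega
    · apply Nat.le_floor
      have h1 := (hdivle p).trans ((hP p hp).abs_cubeResidue_le h)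
      have h2 : 13 * (q * Y * η ^ 2) = 13 * (Y * η ^ 2) * q := by ring
      rw [h2] at h1
      exact le_of_mul_le_mul_right h1 (by linarith)
  have hfiber : ∀ b ∈ Finset.Ico 0 q ×ˢ ((Finset.univ : Finset Bool) ×ˢ Finset.Icc 1 K),
      ((P.filter fun p => key p = b).card : ℝ) ≤
        20491 * (Y * η ^ 2) * √Y / q * (1 / √(b.2.2 : ℝ)) := by
    intro b hb
    rcases (P.filter fun p => key p = b).eq_empty_or_nonempty with he | ⟨p0, hp0⟩
    · rw [he]; simp only [Finset.card_empty, Nat.cast_zero]; positivity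
    rw [Finset.mem_filter] at hp0
    have hk1 : (1 : ℝ) ≤ b.2.2 := by
      simp only [Finset.mem_product, Finset.mem_Icc] at hb
      exact_mod_cast hb.2.2.1
    set l := cubeResidue q p0 with hl0
    have hbl : (b.2.2 : ℝ) * q ≤ |(l : ℝ)| := by
      rw [← hp0.2]; exact hdivle p0
    have hql : (q : ℝ) ≤ |(l : ℝ)| := by nlinarith
    have hlpos : 0 < |(l : ℝ)| := by linarith
    have hcong : ∀ p ∈ P.filter (fun p => key p = b), ∀ p' ∈ P.filter (fun p => key p = b),
        q ∣ p'.1 - p.1 := by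
      intro p hp p' hp'
      have h1 := (Finset.mem_filter.1 hp).2.trans (Finset.mem_filter.1 hp').2.symm
      simp only [hkey, Prod.mk.injEq] at h1
      exact Int.ModEq.dvd h1.1
    have hb' := card_le_of_cubeResidue_eq (l := l) h
      (fun p hp => hP p (Finset.mem_filter.1 hp).1)
      (by intro h0; rw [h0] at hlpos; simp at hlpos) (fun p hp => by
        have h1 := hcong p hp p0 (Finset.mem_filter.2 hp0)
        have h2 := (Finset.mem_filter.1 hp).2.trans hp0.2.symm
        simp only [hkey, Prod.mk.injEq, decide_eq_decide] at h2
        refine eq_of_dvd_sub_of_ediv_eq (dvd_cubeResidue_sub h1) h2.2.1 ?_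
        have h3 := congrArg (Nat.cast : ℕ → ℤ) h2.2.2
        rwa [Int.toNat_of_nonneg (hdivnn p), Int.toNat_of_nonneg (hdivnn p0)] at h3) hcong
    refine hb'.trans ?_
    rw [max_eq_left hql]
    have hs : √(b.2.2 : ℝ) * √q ≤ √|(l : ℝ)| := by
      rw [← Real.sqrt_mul (by positivity)]
      exact Real.sqrt_le_sqrt hbl
    have hsq : √|(l : ℝ)| ^ 2 = |(l : ℝ)| := Real.sq_sqrt (abs_nonneg _)
    have hsl : 0 < √|(l : ℝ)| := Real.sqrt_pos.2 hlpos
    have hsk : 0 < √(b.2.2 : ℝ) := Real.sqrt_pos.2 (by linarith)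
    rw [Real.sqrt_mul (by positivity), Real.sqrt_mul (by positivity)]
    calc 20491 * (Y * η ^ 2) * (√q * √Y * √|(l : ℝ)|) / (q * |(l : ℝ)|)
        = 20491 * (Y * η ^ 2) * √Y / q * (√q / √|(l : ℝ)|) := by
          nth_rewrite 2 [← hsq]; field_simp
      _ ≤ _ := by
          gcongr 20491 * (Y * η ^ 2) * √Y / q * ?_
          rw [div_le_div_iff₀ hsl hsk]
          linarith
  have hsqrtK : √(K : ℝ) ≤ 4 * (√Y * η) := by
    have h1 : (K : ℝ) ≤ 13 * (Y * η ^ 2) := Nat.floor_le (by positivity)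
    apply Real.sqrt_le_iff.2 ⟨by positivity, ?_⟩
    rw [mul_pow, mul_pow, Real.sq_sqrt hY.le]
    have : 0 < Y * η ^ 2 := by positivity
    linarith
  rw [Finset.card_eq_sum_card_fiberwise hmaps, Nat.cast_sum]
  refine (Finset.sum_le_sum hfiber).trans ?_
  rw [← Finset.mul_sum, Finset.sum_product]
  simp only [Finset.sum_product, Finset.sum_const, Finset.card_univ, Fintype.card_bool,
    Int.card_Ico, nsmul_eq_mul, sub_zero]
  have hqc : ((q.toNat : ℕ) : ℝ) = q := by exact_mod_cast Int.toNat_of_nonneg hq0.le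
  rw [hqc]
  have hsum := (sum_Icc_inv_sqrt_le K).trans (mul_le_mul_of_nonneg_left hsqrtK zero_le_two)
  calc 20491 * (Y * η ^ 2) * √Y / q *
        (q * (((2 : ℕ) : ℝ) * ∑ k ∈ Finset.Icc 1 K, 1 / √(k : ℝ)))
      ≤ 20491 * (Y * η ^ 2) * √Y / q * (q * (((2 : ℕ) : ℝ) * (2 * (4 * (√Y * η))))) := by
        gcongr
    _ = 327856 * (Y * √Y ^ 2 * η ^ 3) := by field_simp; push_cast; ring
    _ = _ := by rw [Real.sq_sqrt hY.le]; ring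

theorem card_le_of_abs_cubeResidue_lt (h : Admissible Y η q) (hP : ∀ p ∈ P, IsApprox Y η q p)
    (hl : ∀ p ∈ P, |cubeResidue q p| < q) : (P.card : ℝ) ≤
      (if q = 1 then 175 * (Y * √Y * η) else 0) + 20491 * (Y * √Y * η ^ 2) *
        ∑ x ∈ Finset.Ico 0 q, ∑ l ∈ Finset.Ioo (-q) q,
          if q ∣ x ^ 3 - l then 1 / |(l : ℝ)| else 0 := by
  have hq := h.one_le_cast
  have hq0 : 0 < q := by have := h.one_le; omega
  have hY := h.Y_pos
  have hη := h.pos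
  have hnn : ∀ x l : ℤ, 0 ≤ if q ∣ x ^ 3 - l then 1 / |(l : ℝ)| else 0 := by
    intro x l; split_ifs <;> positivity
  split_ifs with hq1
  · subst hq1
    refine (card_le_of_cubeResidue_eq_zero h hP fun p hp => Int.abs_lt_one_iff.1 (hl p hp)).trans ?_
    refine le_add_of_nonneg_right (mul_nonneg (by positivity) ?_)
    exact Finset.sum_nonneg fun x _ => Finset.sum_nonneg fun l _ => hnn x l
  rw [zero_add, ← Finset.sum_product', Finset.mul_sum]
  have hmaps : ∀ p ∈ P, (p.1 % q, cubeResidue q p) ∈ Finset.Ico 0 q ×ˢ Finset.Ioo (-q) q := by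
    intro p hp
    simp only [Finset.mem_product, Finset.mem_Ico, Finset.mem_Ioo]
    exact ⟨⟨Int.emod_nonneg _ hq0.ne', Int.emod_lt_of_pos _ hq0⟩, abs_lt.1 (hl p hp)⟩
  rw [Finset.card_eq_sum_card_fiberwise hmaps, Nat.cast_sum]
  refine Finset.sum_le_sum fun b _ => ?_
  rcases (P.filter fun p => (p.1 % q, cubeResidue q p) = b).eq_empty_or_nonempty with
    he | ⟨p0, hp0⟩
  · rw [he]; simp only [Finset.card_empty, Nat.cast_zero]
    exact mul_nonneg (by positivity) (hnn _ _)
  obtain ⟨x, l⟩ := b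
  simp only [Finset.mem_filter, Prod.mk.injEq] at hp0
  obtain ⟨hp0P, hx, hl0⟩ := hp0
  have hdvd := dvd_num_pow_sub_cubeResidue q p0
  rw [hl0] at hdvd
  have hl1 : l ≠ 0 := by
    rintro rfl
    rw [sub_zero] at hdvd
    have h1 := (hP p0 hp0P).coprime.symm.pow_right (n := 3) |>.isUnit_of_dvd' dvd_rfl hdvd
    rcases Int.isUnit_iff.1 h1 with h2 | h2 <;> omega
  have hdvd' : q ∣ x ^ 3 - l := by
    have h1 : q ∣ x ^ 3 - p0.1 ^ 3 := by
      refine dvd_trans ?_ (sub_dvd_pow_sub_pow x p0.1 3)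
      rw [← hx]
      exact (Int.mod_modEq p0.1 q).symm.dvd
    have := h1.add hdvd
    rwa [sub_add_sub_cancel] at this
  rw [if_pos hdvd']
  have hmem : ∀ p ∈ P.filter (fun p => (p.1 % q, cubeResidue q p) = (x, l)),
      p ∈ P ∧ p.1 % q = x ∧ cubeResidue q p = l := by
    intro p hp
    simpa only [Finset.mem_filter, Prod.mk.injEq] using hp
  refine (card_le_of_cubeResidue_eq (l := l) h (fun p hp => hP p (hmem p hp).1) hl1
    (fun p hp => (hmem p hp).2.2) (fun p hp p' hp' =>
      Int.ModEq.dvd ((hmem p hp).2.1.trans (hmem p' hp').2.1.symm))).trans ?_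
  have hlq : |(l : ℝ)| ≤ q := by
    have := (hl p0 hp0P).le
    rw [hl0] at this
    exact_mod_cast this
  have hlpos : 0 < |(l : ℝ)| := abs_pos.2 (by exact_mod_cast hl1)
  rw [max_eq_right hlq, mul_right_comm (q : ℝ) Y, ← pow_two, Real.sqrt_mul (by positivity),
    Real.sqrt_sq (by positivity)]
  refine le_of_eq ?_
  field_simp

end Moduli

theorem sum_Icc_inv_abs_le (Q : ℕ) :
    ∑ l ∈ Finset.Icc (-(Q : ℤ)) Q, 1 / |(l : ℝ)| ≤ 2 * (1 + Real.log Q) := by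
  have key : ∀ Q : ℕ, ∑ l ∈ Finset.Icc (-(Q : ℤ)) Q, 1 / |(l : ℝ)| = 2 * (harmonic Q : ℝ) := by
    intro Q
    induction Q with
    | zero => simp
    | succ Q ih =>
      have h1 : Finset.Icc (-((Q + 1 : ℕ) : ℤ)) ((Q + 1 : ℕ) : ℤ) =
          insert ((Q : ℤ) + 1) (insert (-((Q : ℤ) + 1)) (Finset.Icc (-(Q : ℤ)) Q)) := by
        ext x
        simp only [Finset.mem_insert, Finset.mem_Icc]
        push_cast
        omega
      rw [h1, Finset.sum_insert, Finset.sum_insert, ih, harmonic_succ]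
      · push_cast
        rw [abs_neg, abs_of_pos (by positivity : (0 : ℝ) < Q + 1)]
        ring
      · simp only [Finset.mem_Icc]; omega
      · simp only [Finset.mem_insert, Finset.mem_Icc]; omega
  rw [key]
  gcongr
  exact harmonic_le_one_add_log Q

theorem card_filter_dvd_le {C ε : ℝ} (hC : ∀ n : ℕ, n ≠ 0 → (n.divisors.card : ℝ) ≤ C * (n : ℝ) ^ ε)
    (Q : ℕ) {z : ℤ} (hz : z ≠ 0) :
    (((Finset.Icc 1 Q).filter fun q : ℕ => (q : ℤ) ∣ z).card : ℝ) ≤ C * |(z : ℝ)| ^ ε := by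
  have h0 : z.natAbs ≠ 0 := Int.natAbs_ne_zero.2 hz
  have h1 : ((Finset.Icc 1 Q).filter fun q : ℕ => (q : ℤ) ∣ z) ⊆ z.natAbs.divisors := by
    intro q hq
    rw [Nat.mem_divisors]
    exact ⟨Int.natCast_dvd.1 (Finset.mem_filter.1 hq).2, h0⟩
  have h2 := hC _ h0
  rw [Nat.cast_natAbs, Int.cast_abs] at h2
  exact le_trans (by exact_mod_cast Finset.card_le_card h1) h2

/-- The cubes modulo `q`, weighted by the inverses of their representatives of least size,
on average over `q ≤ Q`. -/
theorem sum_cube_residues_le {ε : ℝ} (hε : 0 < ε) : ∃ C : ℝ, 0 < C ∧ ∀ Q : ℕ,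
    ∑ q ∈ Finset.Icc 1 Q, ∑ x ∈ Finset.Ico 0 (q : ℤ), ∑ l ∈ Finset.Ioo (-(q : ℤ)) q,
      (if (q : ℤ) ∣ x ^ 3 - l then 1 / |(l : ℝ)| else 0) ≤ C * (Q : ℝ) ^ (1 + ε) := by
  obtain ⟨C, hC1, hC⟩ := card_divisors_le_rpow (ε := ε / 6) (by positivity)
  refine ⟨(C * 2 ^ (ε / 6) + 1) * (2 * (1 + 1 / (ε / 2))), by positivity, fun Q => ?_⟩
  rcases Nat.eq_zero_or_pos Q with rfl | hQ
  · simp only [zero_lt_one, Finset.Icc_eq_empty_of_lt, Finset.sum_empty]; positivity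
  have hQ1 : (1 : ℝ) ≤ Q := by exact_mod_cast hQ
  set J := Finset.Ico (0 : ℤ) Q
  set I := Finset.Icc (-(Q : ℤ)) Q with hI
  have hnn : ∀ (q : ℕ) (x l : ℤ), 0 ≤ if (q : ℤ) ∣ x ^ 3 - l then 1 / |(l : ℝ)| else 0 := by
    intro q x l; split_ifs <;> positivity
  have hE : 1 ≤ (Q : ℝ) ^ (ε / 2) := Real.one_le_rpow hQ1 (by positivity)
  have step1 : ∑ q ∈ Finset.Icc 1 Q, ∑ x ∈ Finset.Ico 0 (q : ℤ), ∑ l ∈ Finset.Ioo (-(q : ℤ)) q,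
      (if (q : ℤ) ∣ x ^ 3 - l then 1 / |(l : ℝ)| else 0) ≤
      ∑ q ∈ Finset.Icc 1 Q, ∑ x ∈ J, ∑ l ∈ I,
        (if (q : ℤ) ∣ x ^ 3 - l then 1 / |(l : ℝ)| else 0) := by
    refine Finset.sum_le_sum fun q hq => ?_
    have hqQ : (q : ℤ) ≤ Q := by exact_mod_cast (Finset.mem_Icc.1 hq).2
    calc _ ≤ ∑ x ∈ Finset.Ico 0 (q : ℤ), ∑ l ∈ I,
          (if (q : ℤ) ∣ x ^ 3 - l then 1 / |(l : ℝ)| else 0) := by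
          refine Finset.sum_le_sum fun x _ => ?_
          refine Finset.sum_le_sum_of_subset_of_nonneg ?_ fun l _ _ => hnn q x l
          intro l hl
          simp only [hI, Finset.mem_Icc, Finset.mem_Ioo] at hl ⊢
          omega
      _ ≤ _ := by
          refine Finset.sum_le_sum_of_subset_of_nonneg ?_ fun x _ _ =>
            Finset.sum_nonneg fun l _ => hnn q x l
          exact Finset.Ico_subset_Ico_right hqQ
  have step2 : ∑ q ∈ Finset.Icc 1 Q, ∑ x ∈ J, ∑ l ∈ I,
        (if (q : ℤ) ∣ x ^ 3 - l then 1 / |(l : ℝ)| else 0) =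
      ∑ l ∈ I, 1 / |(l : ℝ)| *
        ∑ x ∈ J, (((Finset.Icc 1 Q).filter fun q : ℕ => (q : ℤ) ∣ x ^ 3 - l).card : ℝ) := by
    rw [Finset.sum_comm]
    simp_rw [Finset.sum_comm (s := Finset.Icc 1 Q)]
    rw [Finset.sum_comm]
    refine Finset.sum_congr rfl fun l _ => ?_
    rw [Finset.mul_sum]
    refine Finset.sum_congr rfl fun x _ => ?_
    rw [← Finset.sum_filter, Finset.sum_const, nsmul_eq_mul, mul_comm]
  have step3 : ∀ l ∈ I, ∀ x ∈ J,
      (((Finset.Icc 1 Q).filter fun q : ℕ => (q : ℤ) ∣ x ^ 3 - l).card : ℝ) ≤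
        C * 2 ^ (ε / 6) * (Q : ℝ) ^ (ε / 2) + if x ^ 3 = l then (Q : ℝ) else 0 := by
    intro l hl x hx
    split_ifs with hxl
    · have h1 : ((Finset.Icc 1 Q).filter fun q : ℕ => (q : ℤ) ∣ x ^ 3 - l).card ≤ Q :=
        (Finset.card_filter_le _ _).trans (by simp)
      have h2 : (0 : ℝ) ≤ C * 2 ^ (ε / 6) * (Q : ℝ) ^ (ε / 2) := by positivity
      have h3 : (((Finset.Icc 1 Q).filter fun q : ℕ => (q : ℤ) ∣ x ^ 3 - l).card : ℝ) ≤ Q := by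
        exact_mod_cast h1
      linarith
    · refine (card_filter_dvd_le hC Q (sub_ne_zero.2 hxl)).trans ?_
      have hx' := Finset.mem_Ico.1 hx
      have hl' := Finset.mem_Icc.1 hl
      have hx0 : (0 : ℝ) ≤ x := by exact_mod_cast hx'.1
      have hxQ : (x : ℝ) ≤ Q := by exact_mod_cast hx'.2.le
      have hl0 : -(Q : ℝ) ≤ l := by exact_mod_cast hl'.1
      have hlQ : (l : ℝ) ≤ Q := by exact_mod_cast hl'.2
      have hx3 : (x : ℝ) ^ 3 ≤ (Q : ℝ) ^ 3 := by gcongr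
      have hx3' : (0 : ℝ) ≤ (x : ℝ) ^ 3 := by positivity
      have hQ3 : (Q : ℝ) ≤ (Q : ℝ) ^ 3 := le_self_pow₀ hQ1 (by norm_num)
      have habs : |((x ^ 3 - l : ℤ) : ℝ)| ≤ 2 * (Q : ℝ) ^ 3 := by
        push_cast
        rw [abs_le]; constructor <;> linarith
      have hpow : (2 * (Q : ℝ) ^ 3) ^ (ε / 6) = 2 ^ (ε / 6) * (Q : ℝ) ^ (ε / 2) := by
        rw [Real.mul_rpow (by norm_num) (by positivity), ← Real.rpow_natCast,
          ← Real.rpow_mul (by positivity)]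
        congr 2; push_cast; ring
      rw [add_zero, mul_assoc, ← hpow]
      gcongr
  have step4 : ∀ l ∈ I,
      ∑ x ∈ J, (((Finset.Icc 1 Q).filter fun q : ℕ => (q : ℤ) ∣ x ^ 3 - l).card : ℝ) ≤
        (C * 2 ^ (ε / 6) + 1) * (Q * (Q : ℝ) ^ (ε / 2)) := by
    intro l hl
    refine (Finset.sum_le_sum (step3 l hl)).trans ?_
    rw [Finset.sum_add_distrib, Finset.sum_const, nsmul_eq_mul, ← Finset.sum_filter,
      Finset.sum_const, nsmul_eq_mul]
    have hJ : (J.card : ℝ) = Q := by simp [J]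
    have hone : ((J.filter fun x => x ^ 3 = l).card : ℝ) ≤ 1 := by
      have : (J.filter fun x => x ^ 3 = l).card ≤ 1 := by
        rw [Finset.card_le_one]
        intro x hx y hy
        exact (Odd.pow_inj (n := 3) (by decide)).1
          ((Finset.mem_filter.1 hx).2.trans (Finset.mem_filter.1 hy).2.symm)
      exact_mod_cast this
    rw [hJ]
    have h1 : ((J.filter fun x => x ^ 3 = l).card : ℝ) * Q ≤ 1 * (Q * (Q : ℝ) ^ (ε / 2)) := by
      refine mul_le_mul hone ?_ (by positivity) zero_le_one
      exact le_mul_of_one_le_right (by positivity) hE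
    linarith
  rw [step2] at step1
  refine step1.trans ?_
  calc ∑ l ∈ I, 1 / |(l : ℝ)| *
        ∑ x ∈ J, (((Finset.Icc 1 Q).filter fun q : ℕ => (q : ℤ) ∣ x ^ 3 - l).card : ℝ)
      ≤ ∑ l ∈ I, 1 / |(l : ℝ)| * ((C * 2 ^ (ε / 6) + 1) * (Q * (Q : ℝ) ^ (ε / 2))) :=
        Finset.sum_le_sum fun l hl => mul_le_mul_of_nonneg_left (step4 l hl) (by positivity)
    _ ≤ (2 * (1 + Real.log Q)) * ((C * 2 ^ (ε / 6) + 1) * (Q * (Q : ℝ) ^ (ε / 2))) := by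
        rw [← Finset.sum_mul]
        gcongr
        exact sum_Icc_inv_abs_le Q
    _ ≤ (2 * ((1 + 1 / (ε / 2)) * (Q : ℝ) ^ (ε / 2))) *
          ((C * 2 ^ (ε / 6) + 1) * (Q * (Q : ℝ) ^ (ε / 2))) := by
        gcongr
        have := Real.log_le_rpow_div (x := (Q : ℝ)) (by positivity) (ε := ε / 2) (by positivity)
        have h2 : (1 + 1 / (ε / 2)) * (Q : ℝ) ^ (ε / 2) =
          (Q : ℝ) ^ (ε / 2) + (Q : ℝ) ^ (ε / 2) / (ε / 2) := by ring
        rw [h2]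
        exact add_le_add hE this
    _ = _ := by
        have h3 : (Q : ℝ) ^ (1 + ε) = Q * ((Q : ℝ) ^ (ε / 2) * (Q : ℝ) ^ (ε / 2)) := by
          rw [← Real.rpow_add (by positivity), Real.rpow_add (by positivity), Real.rpow_one,
            add_halves]
        rw [h3]; ring

/-- Dirichlet's approximation theorem, with a bound for the denominator in terms of `η`. -/
theorem exists_isApprox {Y η : ℝ} (hη : 0 < η) (hη1 : η ≤ 1) {m n : ℤ} (hm : 1 ≤ m)
    (hmY : √(m : ℝ) ≤ 2 * Y) (hn : |(n : ℝ) - √(m : ℝ) ^ 3| ≤ η ^ 2) :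
    ∃ (q : ℕ) (a : ℤ), q ∈ Finset.Icc 1 ⌊1 / η⌋₊ ∧ IsApprox Y η q (a, m, n) := by
  have hQ : 0 < ⌊1 / η⌋₊ := Nat.floor_pos.2 ((one_le_div hη).2 hη1)
  obtain ⟨ρ, h1, h2⟩ := Real.exists_rat_abs_sub_le_and_den_le (√(m : ℝ)) hQ
  have hden : (1 : ℝ) ≤ ρ.den := by exact_mod_cast ρ.den_pos
  have hlt : 1 / η < (⌊1 / η⌋₊ : ℝ) + 1 := Nat.lt_floor_add_one _
  have h3 : |ρ.den * √(m : ℝ) - ρ.num| < η := by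
    have h4 : (ρ.den : ℝ) * √(m : ℝ) - ρ.num = ρ.den * (√(m : ℝ) - ρ) := by
      rw [show (ρ : ℝ) = ρ.num / ρ.den from Rat.cast_def ρ]
      field_simp
    rw [h4, abs_mul, abs_of_nonneg (by positivity)]
    calc (ρ.den : ℝ) * |√(m : ℝ) - ρ| ≤ ρ.den * (1 / (((⌊1 / η⌋₊ : ℝ) + 1) * ρ.den)) := by gcongr
      _ = 1 / ((⌊1 / η⌋₊ : ℝ) + 1) := by field_simp
      _ < η := by
        rw [div_lt_iff₀ (by positivity)]
        rw [div_lt_iff₀ hη] at hlt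
        linarith
  refine ⟨ρ.den, ρ.num, Finset.mem_Icc.2 ⟨ρ.den_pos, h2⟩, ?_, hm, ?_, hmY, ?_, hn⟩
  · have h5 : (1 : ℝ) ≤ √(m : ℝ) := Real.one_le_sqrt.2 (by exact_mod_cast hm)
    have h6 := (abs_lt.1 h3).2
    have h7 : (0 : ℝ) < ρ.num := by nlinarith
    have : 0 < ρ.num := by exact_mod_cast h7
    exact this
  · exact Int.isCoprime_iff_gcd_eq_one.2 ρ.reduced
  · simpa using h3.le

/-- The number of integer points within `η²` of the curve `n = m ^ (3/2)`, `m ≤ 4 Y²`. -/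
theorem card_near_curve_le {ε : ℝ} (hε : 0 < ε) : ∃ C : ℝ, 0 < C ∧ ∀ Y η : ℝ, 0 < η → η ≤ 1 →
    1 ≤ Y * η ^ 2 → ∀ S : Finset (ℤ × ℤ),
      (∀ s ∈ S, 1 ≤ s.1 ∧ √(s.1 : ℝ) ≤ 2 * Y ∧ |(s.2 : ℝ) - √(s.1 : ℝ) ^ 3| ≤ η ^ 2) →
      (S.card : ℝ) ≤ C * (Y ^ 2 * η ^ 2 + Y ^ (1 + ε)) := by
  obtain ⟨D, hD0, hD⟩ := sum_cube_residues_le hε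
  refine ⟨327856 + 175 + 20491 * D, by positivity, fun Y η hη hη1 hYη S hS => ?_⟩
  have hY : 0 < Y := pos_of_mul_pos_left (lt_of_lt_of_le one_pos hYη) (sq_nonneg η)
  set Q := ⌊1 / η⌋₊ with hQ
  have hQη : (Q : ℝ) ≤ 1 / η := Nat.floor_le (by positivity)
  have hex : ∀ s : ℤ × ℤ, ∃ q : ℕ, ∃ a : ℤ, s ∈ S →
      q ∈ Finset.Icc 1 Q ∧ IsApprox Y η q (a, s.1, s.2) := by
    intro s
    by_cases hs : s ∈ S
    · obtain ⟨q, a, h⟩ := exists_isApprox hη hη1 (hS s hs).1 (hS s hs).2.1 (hS s hs).2.2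
      exact ⟨q, a, fun _ => h⟩
    · exact ⟨0, 0, fun h => absurd h hs⟩
  choose f g hfg using hex
  have hper : ∀ q ∈ Finset.Icc 1 Q, ((S.filter fun s => f s = q).card : ℝ) ≤
      327856 * (Y ^ 2 * η ^ 3) + ((if q = 1 then 175 * (Y * √Y * η) else 0) +
        20491 * (Y * √Y * η ^ 2) *
          ∑ x ∈ Finset.Ico 0 (q : ℤ), ∑ l ∈ Finset.Ioo (-(q : ℤ)) q,
            if (q : ℤ) ∣ x ^ 3 - l then 1 / |(l : ℝ)| else 0) := by
    intro q hq
    have hadm : Admissible Y η q := by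
      refine ⟨by exact_mod_cast (Finset.mem_Icc.1 hq).1, hη, ?_, hYη⟩
      have h1 : (q : ℝ) ≤ 1 / η :=
        le_trans (by exact_mod_cast (Finset.mem_Icc.1 hq).2) hQη
      rw [le_div_iff₀ hη] at h1
      exact_mod_cast h1
    set P := (S.filter fun s => f s = q).image fun s => (g s, s.1, s.2) with hPdef
    have hPcard : P.card = (S.filter fun s => f s = q).card := by
      apply Finset.card_image_of_injective
      rintro ⟨m, n⟩ ⟨m', n'⟩ h
      simp only [Prod.mk.injEq] at h ⊢
      exact h.2
    have hP : ∀ p ∈ P, IsApprox Y η q p := by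
      intro p hp
      obtain ⟨s, hs, rfl⟩ := Finset.mem_image.1 hp
      obtain ⟨hsS, hsq⟩ := Finset.mem_filter.1 hs
      simpa only [hsq] using (hfg s hsS).2
    rw [← hPcard, ← Finset.card_filter_add_card_filter_not (s := P)
      (fun p => (q : ℤ) ≤ |cubeResidue q p|), Nat.cast_add]
    refine add_le_add (card_le_of_le_abs_cubeResidue hadm
      (fun p hp => hP p (Finset.mem_filter.1 hp).1) fun p hp => (Finset.mem_filter.1 hp).2) ?_
    have := card_le_of_abs_cubeResidue_lt hadm (P := P.filter fun p => ¬ (q : ℤ) ≤ |cubeResidue q p|)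
      (fun p hp => hP p (Finset.mem_filter.1 hp).1) fun p hp => not_le.1 (Finset.mem_filter.1 hp).2
    simpa only [Nat.cast_eq_one] using this
  have hinv : 1 / η ≤ √Y := by
    rw [div_le_iff₀ hη, ← Real.sqrt_sq hη.le, ← Real.sqrt_mul hY.le]
    exact Real.one_le_sqrt.2 hYη
  have h1inv : 1 ≤ 1 / η := (one_le_div hη).2 hη1
  set u := √Y ^ (1 + ε) with hu
  have hQu : (Q : ℝ) ^ (1 + ε) ≤ (1 / η) * √Y ^ ε := by
    calc (Q : ℝ) ^ (1 + ε) ≤ (1 / η) ^ (1 + ε) := by gcongr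
      _ = (1 / η) * (1 / η) ^ ε := by rw [Real.rpow_add (by positivity), Real.rpow_one]
      _ ≤ _ := by gcongr
  have hu' : u = √Y * √Y ^ ε := by
    rw [hu, Real.rpow_add (by positivity), Real.rpow_one]
  have husq : u ^ 2 = Y ^ (1 + ε) := by
    rw [hu, ← Real.rpow_natCast, ← Real.rpow_mul (Real.sqrt_nonneg _), mul_comm,
      Real.rpow_mul (Real.sqrt_nonneg _), Real.rpow_natCast, Real.sq_sqrt hY.le]
  have h1e : 1 ≤ √Y ^ ε := Real.one_le_rpow (h1inv.trans hinv) hε.le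
  have hmaps : ∀ s ∈ S, f s ∈ Finset.Icc 1 Q := fun s hs => (hfg s hs).1
  rw [Finset.card_eq_sum_card_fiberwise hmaps, Nat.cast_sum]
  refine (Finset.sum_le_sum hper).trans ?_
  rw [Finset.sum_add_distrib, Finset.sum_add_distrib, Finset.sum_const,
    Finset.sum_ite_eq', nsmul_eq_mul, Nat.card_Icc, Nat.add_sub_cancel, ← Finset.mul_sum]
  have hamgm : Y * η * u ≤ Y ^ 2 * η ^ 2 + Y ^ (1 + ε) := by
    rw [← husq]
    nlinarith [sq_nonneg (Y * η - u), sq_nonneg (Y * η), sq_nonneg u]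
  have t1 : (Q : ℝ) * (327856 * (Y ^ 2 * η ^ 3)) ≤ 327856 * (Y ^ 2 * η ^ 2 + Y ^ (1 + ε)) := by
    calc (Q : ℝ) * (327856 * (Y ^ 2 * η ^ 3)) ≤ 1 / η * (327856 * (Y ^ 2 * η ^ 3)) := by gcongr
      _ = 327856 * (Y ^ 2 * η ^ 2) := by field_simp
      _ ≤ _ := by
        have : 0 < Y ^ (1 + ε) := by positivity
        linarith
  have t2 : (if 1 ∈ Finset.Icc 1 Q then 175 * (Y * √Y * η) else 0) ≤
      175 * (Y ^ 2 * η ^ 2 + Y ^ (1 + ε)) := by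
    have h5 : Y * √Y * η ≤ Y * η * u := by
      rw [hu']
      calc Y * √Y * η = Y * η * (√Y * 1) := by ring
        _ ≤ _ := by gcongr
    split_ifs
    · linarith
    · positivity
  have t3 : 20491 * (Y * √Y * η ^ 2) * ∑ q ∈ Finset.Icc 1 Q,
      ∑ x ∈ Finset.Ico 0 (q : ℤ), ∑ l ∈ Finset.Ioo (-(q : ℤ)) q,
        (if (q : ℤ) ∣ x ^ 3 - l then 1 / |(l : ℝ)| else 0) ≤
      20491 * D * (Y ^ 2 * η ^ 2 + Y ^ (1 + ε)) := by
    calc _ ≤ 20491 * (Y * √Y * η ^ 2) * (D * (1 / η * √Y ^ ε)) := by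
          gcongr
          exact (hD Q).trans (mul_le_mul_of_nonneg_left hQu hD0.le)
      _ = 20491 * D * (Y * η * u) := by rw [hu']; field_simp
      _ ≤ _ := by gcongr
  linarith

section Count

variable {N X : ℝ}

theorem card_le_of_large (hN : 1 ≤ N) (hXN : X ≤ N ^ 2) (hX : N ≤ 2 * X) {Y : ℝ} (hY : 1 ≤ Y)
    (hYN : Y ^ 3 = N) (S : Finset (ℤ × ℤ))
    (hS : ∀ s ∈ S, N ≤ (s.2 : ℝ) ∧ (s.2 : ℝ) ≤ 2 * N ∧ |(s.2 : ℝ) ^ 2 - (s.1 : ℝ) ^ 3| ≤ X) :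
    (S.card : ℝ) ≤ 20 * (X * Y ^ 2 / N) := by
  have hX0 : 0 < X := by linarith
  have himg : ((S.image Prod.fst).card : ℝ) ≤ 5 * Y ^ 2 := by
    refine (card_le_of_separated _ (d := 1) (c := 0) (W := 2 * Y ^ 2) one_pos (by positivity)
      ?_ ?_).trans ?_
    · intro m hm
      obtain ⟨s, hs, rfl⟩ := Finset.mem_image.1 hm
      obtain ⟨h1, h2, h3⟩ := hS s hs
      rw [abs_le] at h3
      have h4 : N ^ 2 ≤ (s.2 : ℝ) ^ 2 := by gcongr
      have h5 : (s.2 : ℝ) ^ 2 ≤ (2 * N) ^ 2 := by gcongr; linarith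
      have h6 : (0 : ℝ) ≤ s.1 := by
        by_contra hneg
        have := Odd.pow_neg (n := 3) (by decide) (not_le.1 hneg)
        linarith
      rw [sub_zero, abs_of_nonneg h6]
      refine le_of_pow_le_pow_left₀ (n := 3) (by norm_num) (by positivity) ?_
      have h7 : (2 * Y ^ 2) ^ 3 = 8 * N ^ 2 := by rw [← hYN]; ring
      rw [h7]
      nlinarith
    · intro x _ y _ hxy
      have : (x : ℝ) + 1 ≤ y := by exact_mod_cast hxy
      linarith
    · nlinarith
  refine (card_le_mul_card_image_of_le S Prod.fst (B := 4 * (X / N)) ?_).trans ?_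
  · intro m hm
    obtain ⟨s0, hs0, hm0⟩ := Finset.mem_image.1 hm
    have hinj : Set.InjOn Prod.snd ((S.filter fun s => s.1 = m : Finset (ℤ × ℤ)) : Set (ℤ × ℤ)) := by
      intro s hs s' hs' h
      simp only [Finset.coe_filter, Set.mem_ofPred_eq] at hs hs'
      exact Prod.ext (hs.2.trans hs'.2.symm) h
    rw [← Finset.card_image_of_injOn hinj]
    refine (card_le_of_separated _ (d := 1) (c := s0.2) (W := X / N) one_pos (by positivity)
      ?_ ?_).trans ?_
    · intro n hn
      obtain ⟨s, hs, rfl⟩ := Finset.mem_image.1 hn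
      obtain ⟨hs, hsm⟩ := Finset.mem_filter.1 hs
      obtain ⟨h1, h2, h3⟩ := hS s hs
      obtain ⟨h1', h2', h3'⟩ := hS s0 hs0
      rw [hsm] at h3
      rw [hm0] at h3'
      rw [le_div_iff₀ (by linarith)]
      have h4 : |(s.2 : ℝ) - s0.2| * (s.2 + s0.2) ≤ 2 * X := by
        rw [← abs_of_nonneg (by linarith : (0 : ℝ) ≤ s.2 + s0.2), ← abs_mul]
        rw [abs_le] at h3 h3' ⊢
        constructor <;> nlinarith
      have h5 : |(s.2 : ℝ) - s0.2| * (2 * N) ≤ |(s.2 : ℝ) - s0.2| * (s.2 + s0.2) := by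
        gcongr; linarith
      linarith
    · intro x _ y _ hxy
      have : (x : ℝ) + 1 ≤ y := by exact_mod_cast hxy
      linarith
    · have : 1 ≤ 2 * (X / N) := by
        rw [← mul_div_assoc, one_le_div (by linarith)]; exact hX
      rw [div_one]; linarith
  · refine (mul_le_mul_of_nonneg_left himg (by positivity)).trans (le_of_eq ?_)
    ring

theorem near_curve_of_small (hN : 1 ≤ N) (hX : 2 * X < N) {Y : ℝ} (hY : 1 ≤ Y)
    (hYN : Y ^ 3 = N) {m n : ℤ} (h1 : N ≤ (n : ℝ)) (h2 : (n : ℝ) ≤ 2 * N)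
    (h3 : |(n : ℝ) ^ 2 - (m : ℝ) ^ 3| ≤ X) :
    1 ≤ m ∧ √(m : ℝ) ≤ 2 * Y ∧ |(n : ℝ) - √(m : ℝ) ^ 3| ≤ X / N := by
  have h3' := abs_le.1 h3
  have h4 : N ^ 2 ≤ (n : ℝ) ^ 2 := by gcongr
  have h5 : (n : ℝ) ^ 2 ≤ (2 * N) ^ 2 := by gcongr; linarith
  have hm : (0 : ℝ) < m := by
    by_contra hneg
    have := Odd.pow_nonpos (n := 3) (by decide) (not_lt.1 hneg)
    nlinarith
  have hs0 := Real.sqrt_nonneg (m : ℝ)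
  have hs2 : √(m : ℝ) ^ 2 = m := Real.sq_sqrt hm.le
  have hs6 : (√(m : ℝ) ^ 3) ^ 2 = (m : ℝ) ^ 3 := by
    nth_rewrite 2 [← hs2]; ring
  refine ⟨by exact_mod_cast hm, ?_, ?_⟩
  · refine le_of_pow_le_pow_left₀ (n := 6) (by norm_num) (by positivity) ?_
    have h7 : (2 * Y) ^ 6 = 64 * N ^ 2 := by rw [← hYN]; ring
    have h8 : √(m : ℝ) ^ 6 = (m : ℝ) ^ 3 := by rw [← hs6]; ring
    rw [h7, h8]
    nlinarith
  · rw [le_div_iff₀ (by linarith)]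
    have hs3 : 0 ≤ √(m : ℝ) ^ 3 := by positivity
    calc |(n : ℝ) - √(m : ℝ) ^ 3| * N ≤ |(n : ℝ) - √(m : ℝ) ^ 3| * (n + √(m : ℝ) ^ 3) := by
          gcongr; linarith
      _ = |(n : ℝ) ^ 2 - (m : ℝ) ^ 3| := by
          rw [← hs6, sq_sub_sq, abs_mul, abs_of_nonneg (by linarith : 0 ≤ (n : ℝ) + √(m : ℝ) ^ 3),
            mul_comm]
      _ ≤ X := h3

end Count

/-- For every `ε > 0` there exists `C = C(ε) > 0` such that for all reals `X ≥ 1` and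
`N ≥ X^{1/2}`, writing `M = N^{2/3}`, one has `T(N,X) ≤ C (X·M/N + N^{1/3+ε})`. -/
theorem mordell_count_bound :
    ∀ ε : ℝ, 0 < ε → ∃ C : ℝ, 0 < C ∧ ∀ X N : ℝ, 1 ≤ X → X ^ ((1 : ℝ) / 2) ≤ N →
      (T N X : ℝ) ≤ C * (X * N ^ ((2 : ℝ) / 3) / N + N ^ ((1 : ℝ) / 3 + ε)) := by
  intro ε hε
  obtain ⟨C, hC0, hC⟩ := card_near_curve_le hε
  refine ⟨20 + 2 * C, by positivity, fun X N hX hXN => ?_⟩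
  have hN : 1 ≤ N := (Real.one_le_rpow hX (by norm_num)).trans hXN
  have hX2 : X ≤ N ^ 2 := by
    rw [← Real.sqrt_eq_rpow] at hXN
    exact (Real.sqrt_le_left (by linarith)).1 hXN
  set Y := N ^ ((1 : ℝ) / 3) with hYdef
  have hY : 1 ≤ Y := Real.one_le_rpow hN (by norm_num)
  have hYN : Y ^ 3 = N := by
    rw [hYdef, ← Real.rpow_natCast, ← Real.rpow_mul (by linarith)]; norm_num
  have hY2 : N ^ ((2 : ℝ) / 3) = Y ^ 2 := by
    rw [hYdef, ← Real.rpow_natCast, ← Real.rpow_mul (by linarith)]; norm_num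
  have hYε : Y ^ (1 + ε) ≤ N ^ ((1 : ℝ) / 3 + ε) := by
    rw [hYdef, ← Real.rpow_mul (by linarith)]
    apply Real.rpow_le_rpow_of_exponent_le hN
    linarith
  have hYle : Y ≤ Y ^ (1 + ε) := by
    nth_rewrite 1 [← Real.rpow_one Y]
    apply Real.rpow_le_rpow_of_exponent_le hY
    linarith
  rw [hY2]
  set E := N ^ ((1 : ℝ) / 3 + ε)
  have hE : 0 < E := by linarith
  have hA : 0 < X * Y ^ 2 / N := by positivity
  rw [T]
  set A : Set (ℤ × ℤ) := _
  rcases A.finite_or_infinite with hfin | hinf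
  swap
  · rw [hinf.ncard]; simp only [Nat.cast_zero]; positivity
  rw [Set.ncard_eq_toFinset_card A hfin]
  have hS : ∀ s ∈ hfin.toFinset, N ≤ (s.2 : ℝ) ∧ (s.2 : ℝ) ≤ 2 * N ∧
      |(s.2 : ℝ) ^ 2 - (s.1 : ℝ) ^ 3| ≤ X := fun s hs => hfin.mem_toFinset.1 hs
  rcases le_or_gt N (2 * X) with hbig | hsmall
  · refine (card_le_of_large hN hX2 hbig hY hYN _ hS).trans ?_
    have : 0 < C * (X * Y ^ 2 / N + E) := by positivity
    nlinarith
  · set δ := max (X / N) (1 / Y) with hδ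
    have hδ0 : 0 < δ := lt_max_of_lt_right (by positivity)
    have hδ1 : δ ≤ 1 := max_le ((div_le_one (by linarith)).2 (by linarith))
      ((div_le_one (by linarith)).2 hY)
    have hηsq : √δ ^ 2 = δ := Real.sq_sqrt hδ0.le
    have hYδ : 1 ≤ Y * δ := by
      calc 1 = Y * (1 / Y) := by field_simp
        _ ≤ _ := by gcongr; exact le_max_right _ _
    have hcard := hC Y (√δ) (Real.sqrt_pos.2 hδ0) (Real.sqrt_le_one.2 hδ1) (by rwa [hηsq])
      hfin.toFinset (fun s hs => by
        obtain ⟨h1, h2, h3⟩ := hS s hs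
        obtain ⟨k1, k2, k3⟩ := near_curve_of_small hN hsmall hY hYN h1 h2 h3
        rw [hηsq]
        exact ⟨k1, k2, k3.trans (le_max_left _ _)⟩)
    rw [hηsq] at hcard
    have hδle : Y ^ 2 * δ ≤ X * Y ^ 2 / N + E := by
      have h1 : δ ≤ X / N + 1 / Y := max_le (le_add_of_nonneg_right (by positivity))
        (le_add_of_nonneg_left (by positivity))
      calc Y ^ 2 * δ ≤ Y ^ 2 * (X / N + 1 / Y) := by gcongr
        _ = X * Y ^ 2 / N + Y := by field_simp
        _ ≤ _ := by linarith
    calc _ ≤ _ := hcard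
      _ ≤ C * (2 * (X * Y ^ 2 / N + E)) := by gcongr; linarith
      _ ≤ _ := by nlinarith
end

section
/- Suppose in addition that w₁ and w₂ are nonnegative, that w₂(t) = 1 for all t ∈ [−1,1], and that there exists η with 0 < η < (2/9)^{1/3} such that w₁(t) = 1 for all t ∈ [η, η^{−1}]. Then for all reals N, X > 0 with N² ≥ 2X, one has T(N,X) ≤ T_S(N,X). -/
/-- The smoothed counting function
`T_S(N,X) = Σ_{m,n ∈ ℤ} w₁(m/M) w₂(Z(n − m^{3/2}))`, where `M = N^{2/3}`, `Z = N/X`. -/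
noncomputable def TS (w₁ w₂ : ℝ → ℝ) (N X : ℝ) : ℝ :=
  ∑' p : ℤ × ℤ,
    w₁ ((p.1 : ℝ) / N ^ ((2 : ℝ) / 3)) *
      w₂ ((N / X) * ((p.2 : ℝ) - ((p.1 : ℝ)) ^ ((3 : ℝ) / 2)))

/-- Only finitely many integers `n` satisfy `|a (n - c)| ≤ R`, for `a > 0`. -/
lemma finite_int_abs_mul_sub_le {a : ℝ} (ha : 0 < a) (c R : ℝ) :
    {n : ℤ | |a * ((n : ℝ) - c)| ≤ R}.Finite := by
  refine (Set.finite_Icc ⌊c - R / a⌋ ⌈c + R / a⌉).subset fun n hn => ?_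
  rw [Set.mem_ofPred_eq, abs_mul, abs_of_pos ha, mul_comm, ← le_div_iff₀ ha, abs_le] at hn
  constructor
  · exact_mod_cast (Int.floor_le _).trans (by linarith [hn.1] : c - R / a ≤ (n : ℝ))
  · exact_mod_cast (by linarith [hn.2] : (n : ℝ) ≤ c + R / a).trans (Int.le_ceil _)

/-- A compactly supported function on `ℝ` vanishes outside some symmetric interval. -/
lemma HasCompactSupport.exists_abs_le {w : ℝ → ℝ} (hw : HasCompactSupport w) :
    ∃ R : ℝ, ∀ t, w t ≠ 0 → |t| ≤ R := by
  obtain ⟨R, hR⟩ := hw.isCompact.isBounded.exists_norm_le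
  exact ⟨R, fun t ht => hR t (subset_tsupport w ht)⟩

/-- Only finitely many terms of the series defining `TS` are nonzero. -/
lemma finite_support_smoothed_term {w₁ w₂ : ℝ → ℝ} (hc₁ : HasCompactSupport w₁)
    (hc₂ : HasCompactSupport w₂) {M Z : ℝ} (hM : 0 < M) (hZ : 0 < Z) (f : ℤ → ℝ) :
    (Function.support fun p : ℤ × ℤ =>
      w₁ ((p.1 : ℝ) / M) * w₂ (Z * ((p.2 : ℝ) - f p.1))).Finite := by
  obtain ⟨R₁, hR₁⟩ := hc₁.exists_abs_le
  obtain ⟨R₂, hR₂⟩ := hc₂.exists_abs_le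
  refine ((finite_int_abs_mul_sub_le (inv_pos.2 hM) 0 R₁).biUnion fun m _ =>
    (finite_int_abs_mul_sub_le hZ (f m) R₂).image (Prod.mk m)).subset ?_
  rintro ⟨m, n⟩ hp
  have h := mul_ne_zero_iff.1 hp
  refine Set.mem_biUnion (x := m) ?_ ⟨n, hR₂ _ h.2, rfl⟩
  have := hR₁ _ h.1
  rwa [div_eq_inv_mul, ← sub_zero (m : ℝ)] at this

/-- If `n ≥ N` and `n² - m³` is at most `X` in absolute value,
then `n` is within `X / N` of `m^{3/2}`. -/
lemma abs_mul_sub_rpow_le_one {N X m n : ℝ} (hN : 0 < N) (hX : 0 < X) (hm : 0 ≤ m)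
    (hn : N ≤ n) (h : |n ^ 2 - m ^ 3| ≤ X) :
    |N / X * (n - m ^ ((3 : ℝ) / 2))| ≤ 1 := by
  set y := m ^ ((3 : ℝ) / 2) with hy
  have hy0 : 0 ≤ y := Real.rpow_nonneg hm _
  have hy2 : y ^ 2 = m ^ 3 := by
    rw [hy, ← Real.rpow_natCast, ← Real.rpow_mul hm, ← Real.rpow_natCast]
    norm_num
  rw [← hy2, sq_sub_sq, abs_mul, abs_of_pos (by linarith : 0 < n + y)] at h
  rw [abs_mul, abs_of_pos (div_pos hN hX), div_mul_eq_mul_div, div_le_one hX]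
  exact (mul_le_mul_of_nonneg_right (by linarith) (abs_nonneg _)).trans h

/-- If `N² / 2 ≤ m³ ≤ 9 N² / 2`, then `m / N^{2/3}` lies in `[η, η⁻¹]` whenever
`0 < η < (2/9)^{1/3}`. -/
lemma div_rpow_mem_Icc {N m η : ℝ} (hN : 0 < N) (hη₀ : 0 < η)
    (hη₁ : η < (2 / 9 : ℝ) ^ ((1 : ℝ) / 3)) (hm : 0 < m)
    (h₁ : N ^ 2 / 2 ≤ m ^ 3) (h₂ : m ^ 3 ≤ 9 / 2 * N ^ 2) :
    m / N ^ ((2 : ℝ) / 3) ∈ Set.Icc η η⁻¹ := by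
  have hM : 0 < N ^ ((2 : ℝ) / 3) := Real.rpow_pos_of_pos hN _
  have hM3 : (N ^ ((2 : ℝ) / 3)) ^ 3 = N ^ 2 := by
    rw [← Real.rpow_natCast, ← Real.rpow_mul hN.le, ← Real.rpow_natCast]
    norm_num
  have hη3 : η ^ 3 < 2 / 9 := by
    refine (pow_lt_pow_left₀ hη₁ hη₀.le three_ne_zero).trans_eq ?_
    rw [← Real.rpow_natCast, ← Real.rpow_mul (by norm_num)]
    norm_num
  have hN2 : 0 < N ^ 2 := by positivity
  constructor
  · rw [le_div_iff₀ hM]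
    refine le_of_pow_le_pow_left₀ three_ne_zero hm.le ?_
    rw [mul_pow, hM3]
    nlinarith
  · rw [div_le_iff₀ hM, ← div_eq_inv_mul, le_div_iff₀ hη₀]
    refine le_of_pow_le_pow_left₀ three_ne_zero hM.le ?_
    rw [mul_pow, hM3]
    have := mul_le_mul h₂ hη3.le (by positivity) (by positivity)
    linarith

/-- If moreover `w₁, w₂ ≥ 0`, `w₂ = 1` on `[−1,1]`, and `w₁ = 1` on `[η, η⁻¹]` for some
`0 < η < (2/9)^{1/3}`, then for all `N, X > 0` with `N² ≥ 2X` one has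
`T(N,X) ≤ T_S(N,X)`. -/
theorem count_le_smoothed_count (w₁ w₂ : ℝ → ℝ)
    (hw₁ : ContDiff ℝ (⊤ : ℕ∞) w₁) (hw₂ : ContDiff ℝ (⊤ : ℕ∞) w₂)
    (hc₁ : HasCompactSupport w₁) (hc₂ : HasCompactSupport w₂)
    (hsupp : Function.support w₁ ⊆ Set.Ioi 0)
    (hnn₁ : ∀ t, 0 ≤ w₁ t) (hnn₂ : ∀ t, 0 ≤ w₂ t)
    (hone₂ : ∀ t ∈ Set.Icc (-1 : ℝ) 1, w₂ t = 1)
    (η : ℝ) (hη₀ : 0 < η) (hη₁ : η < (2 / 9 : ℝ) ^ ((1 : ℝ) / 3))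
    (hone₁ : ∀ t ∈ Set.Icc η η⁻¹, w₁ t = 1) :
    ∀ N X : ℝ, 0 < N → 0 < X → 2 * X ≤ N ^ 2 →
      (T N X : ℝ) ≤ TS w₁ w₂ N X := by
  intro N X hN hX hNX
  set F : ℤ × ℤ → ℝ := fun p => w₁ ((p.1 : ℝ) / N ^ ((2 : ℝ) / 3)) *
    w₂ ((N / X) * ((p.2 : ℝ) - ((p.1 : ℝ)) ^ ((3 : ℝ) / 2))) with hF
  set S : Set (ℤ × ℤ) := {p | N ≤ (p.2 : ℝ) ∧ (p.2 : ℝ) ≤ 2 * N ∧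
    |((p.2 : ℝ)) ^ 2 - ((p.1 : ℝ)) ^ 3| ≤ X} with hS
  have hfin : (Function.support F).Finite :=
    finite_support_smoothed_term hc₁ hc₂ (Real.rpow_pos_of_pos hN _) (div_pos hN hX)
      fun m => (m : ℝ) ^ ((3 : ℝ) / 2)
  have hone : ∀ p ∈ S, F p = 1 := by
    rintro ⟨m, n⟩ ⟨hn₁, hn₂, h⟩
    dsimp only at hn₁ hn₂ h
    have h' := abs_le.1 h
    have h₁ : N ^ 2 / 2 ≤ (m : ℝ) ^ 3 := by nlinarith
    have h₂ : (m : ℝ) ^ 3 ≤ 9 / 2 * N ^ 2 := by nlinarith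
    have hm : 0 < (m : ℝ) := by
      rw [← Odd.pow_pos_iff (n := 3) (by decide)]
      exact lt_of_lt_of_le (by positivity) h₁
    rw [hF]
    dsimp only
    rw [hone₁ _ (div_rpow_mem_Icc hN hη₀ hη₁ hm h₁ h₂),
      hone₂ _ (abs_le.1 (abs_mul_sub_rpow_le_one hN hX hm.le hn₁ h)), one_mul]
  have hSfin : S.Finite := hfin.subset fun p hp => by
    rw [Function.mem_support, hone p hp]
    exact one_ne_zero
  calc (T N X : ℝ) = ∑ p ∈ hSfin.toFinset, F p := by
        rw [Finset.sum_congr rfl fun p hp => hone p (hSfin.mem_toFinset.1 hp), T,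
          Set.ncard_eq_toFinset_card _ hSfin]
        simp
    _ ≤ ∑' p, F p := (summable_of_hasFiniteSupport hfin).sum_le_tsum _
        fun p _ => mul_nonneg (hnn₁ _) (hnn₂ _)
end
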